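/- arXiv:2307.09419 — 3 statements merged into one kernel-verified Lean document; each statement's English description precedes it below -/
import Mathlib

section
/- Let ν ≥ 2 be an integer, let j be an integer with 1 ≤ j ≤ ν, and let r be an integer with j ≤ r ≤ ν and not (r = j = ν). Then the double-primed sum Σ''_{k=0}^{ν} β_k^j · V_r(-cos(kπ/ν)) equals 0. -/
open Real

/-- Chebyshev polynomials of the third kind, as functions on ℝ. -/
noncomputable def chebV : ℕ → ℝ → ℝ
  | 0, _ => 1
  | 1, x => 2 * x - 1
  | (n + 2), x => 2 * x * chebV (n + 1) x - chebV n x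

/-- Double-primed sum `Σ''_{k=0}^{ν} f k`: first and last terms are halved. -/
noncomputable def dsum (ν : ℕ) (f : ℕ → ℝ) : ℝ :=
  ∑ k ∈ Finset.range (ν + 1), if k = 0 ∨ k = ν then f k / 2 else f k

/-- The double-primed sum is the composite trapezoidal rule. -/
theorem dsum_eq_trapezoid {ν : ℕ} (hν : 1 ≤ ν) (f : ℕ → ℝ) :
    dsum ν f = ∑ k ∈ Finset.range ν, (f k + f (k + 1)) / 2 := by
  obtain ⟨n, rfl⟩ : ∃ n, ν = n + 1 := ⟨ν - 1, by omega⟩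
  have hmid : ∀ k ∈ Finset.range n,
      (if k + 1 = 0 ∨ k + 1 = n + 1 then f (k + 1) / 2 else f (k + 1)) = f (k + 1) := by
    intro k hk
    have hk' := Finset.mem_range.mp hk
    exact if_neg (by omega)
  rw [dsum, Finset.sum_range_succ, Finset.sum_range_succ', Finset.sum_congr rfl hmid,
    ← Finset.sum_div, Finset.sum_add_distrib, Finset.sum_range_succ' f,
    Finset.sum_range_succ (fun k => f (k + 1))]
  simp only [true_or, or_true, if_true]
  ring

theorem dsum_add (ν : ℕ) (f g : ℕ → ℝ) :
    dsum ν (fun k => f k + g k) = dsum ν f + dsum ν g := by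
  simp only [dsum, ← Finset.sum_add_distrib]
  refine Finset.sum_congr rfl fun k _ => ?_
  split_ifs <;> ring

theorem dsum_const_mul (ν : ℕ) (c : ℝ) (f : ℕ → ℝ) :
    dsum ν (fun k => c * f k) = c * dsum ν f := by
  simp only [dsum, Finset.mul_sum]
  refine Finset.sum_congr rfl fun k _ => ?_
  split_ifs <;> ring

/-- Discrete orthogonality of the cosines to the constants. -/
theorem dsum_cos_eq_zero {ν m : ℕ} (hm : 0 < m) (hmν : m < 2 * ν) :
    dsum ν (fun k => Real.cos (m * (k * π / ν))) = 0 := by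
  have hν : 1 ≤ ν := by omega
  have hν0 : (0 : ℝ) < ν := by exact_mod_cast hν
  have hm0 : (0 : ℝ) < m := by exact_mod_cast hm
  have hmν' : (m : ℝ) < 2 * ν := by exact_mod_cast hmν
  obtain ⟨γ, hγ⟩ : ∃ γ : ℝ, γ = m * π / (2 * ν) := ⟨_, rfl⟩
  have hsin : Real.sin γ ≠ 0 := by
    refine (Real.sin_pos_of_pos_of_lt_pi ?_ ?_).ne'
    · rw [hγ]; positivity
    · rw [hγ, div_lt_iff₀ (by positivity), mul_comm π]
      exact mul_lt_mul_of_pos_right hmν' Real.pi_pos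
  have harg : ∀ k : ℕ, (m : ℝ) * (k * π / ν) = 2 * k * γ := by
    intro k
    rw [hγ]
    field_simp
  have hend : Real.sin (2 * ν * γ) = 0 := by
    rw [← harg, mul_div_cancel_left₀ _ hν0.ne', Real.sin_nat_mul_pi]
  have hterm : ∀ k : ℕ,
      Real.sin γ * ((Real.cos (2 * k * γ) + Real.cos (2 * (k + 1 : ℕ) * γ)) / 2) =
        Real.cos γ / 2 * (Real.sin (2 * (k + 1 : ℕ) * γ) - Real.sin (2 * k * γ)) := by
    intro k
    have h : 2 * ((k + 1 : ℕ) : ℝ) * γ = 2 * k * γ + 2 * γ := by push_cast; ring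
    rw [h, Real.cos_add, Real.sin_add, Real.cos_two_mul, Real.sin_two_mul]
    linear_combination (-Real.sin (2 * k * γ) * Real.cos γ) * Real.sin_sq_add_cos_sq γ
  apply (mul_eq_zero.mp _).resolve_left hsin
  simp only [harg]
  rw [dsum_eq_trapezoid hν, Finset.mul_sum, Finset.sum_congr rfl fun k _ => hterm k,
    ← Finset.mul_sum, Finset.sum_range_sub (fun k : ℕ => Real.sin (2 * k * γ)), hend]
  simp

theorem cos_add_two_mul (m : ℕ) (φ : ℝ) :
    Real.cos ((m + 2 : ℕ) * φ) + Real.cos (m * φ) =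
      2 * Real.cos φ * Real.cos ((m + 1 : ℕ) * φ) := by
  have h₂ : ((m + 2 : ℕ) : ℝ) * φ = (m + 1 : ℕ) * φ + φ := by push_cast; ring
  have h₀ : (m : ℝ) * φ = (m + 1 : ℕ) * φ - φ := by push_cast; ring
  rw [h₂, h₀, Real.cos_add, Real.cos_sub]
  ring

/-- Trigonometric form of `(1 + x) V_r(x) = T_r(x) + T_{r+1}(x)` at `x = -cos φ`. -/
theorem one_sub_cos_mul_chebV (φ : ℝ) (r : ℕ) :
    (1 - Real.cos φ) * chebV r (-Real.cos φ) =
      (-1) ^ r * Real.cos (r * φ) + (-1) ^ (r + 1) * Real.cos ((r + 1 : ℕ) * φ) := by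
  induction r using Nat.twoStepInduction with
  | zero => simp [chebV]; ring
  | one =>
    have h := cos_add_two_mul 0 φ
    simp only [Nat.cast_zero, zero_mul, Real.cos_zero, Nat.zero_add, Nat.cast_one,
      one_mul] at h
    simp only [chebV, Nat.cast_one, one_mul, Nat.reduceAdd]
    linear_combination -h
  | more r ih₀ ih₁ =>
    have h₀ := cos_add_two_mul r φ
    have h₁ := cos_add_two_mul (r + 1) φ
    rw [chebV]
    simp only [add_assoc, Nat.reduceAdd] at *
    simp only [pow_add] at *
    linear_combination
      -2 * Real.cos φ * ih₁ - ih₀ - (-1) ^ r * h₀ + (-1) ^ r * h₁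

/-- Discrete orthogonality of `T_m` to polynomials of degree `i` at the Chebyshev extrema. -/
theorem dsum_pow_mul_cos_eq_zero {ν : ℕ} (i m : ℕ) (him : i < m) (hmν : i + m < 2 * ν) :
    dsum ν (fun k => ((1 - Real.cos (k * π / ν)) / 2) ^ i *
      Real.cos (m * (k * π / ν))) = 0 := by
  induction i generalizing m with
  | zero => simpa using dsum_cos_eq_zero him (by omega)
  | succ i ih =>
    obtain ⟨n, rfl⟩ : ∃ n, m = n + 1 := ⟨m - 1, by omega⟩
    have hsplit : ∀ k : ℕ, ((1 - Real.cos (k * π / ν)) / 2) ^ (i + 1) *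
        Real.cos ((n + 1 : ℕ) * (k * π / ν)) =
        1 / 2 * (((1 - Real.cos (k * π / ν)) / 2) ^ i *
          Real.cos ((n + 1 : ℕ) * (k * π / ν))) +
        (-1 / 4 * (((1 - Real.cos (k * π / ν)) / 2) ^ i * Real.cos (n * (k * π / ν))) +
        -1 / 4 * (((1 - Real.cos (k * π / ν)) / 2) ^ i *
          Real.cos ((n + 2 : ℕ) * (k * π / ν)))) := by
      intro k
      rw [pow_succ]
      linear_combination (1 / 4 * ((1 - Real.cos (k * π / ν)) / 2) ^ i) *
        cos_add_two_mul n (k * π / ν)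
    simp only [hsplit, dsum_add, dsum_const_mul]
    rw [ih (n + 1) (by omega) (by omega), ih n (by omega) (by omega),
      ih (n + 2) (by omega) (by omega)]
    ring

/-- Lemma 3.2, vanishing case: for ν ≥ 2, 1 ≤ j ≤ ν, j ≤ r ≤ ν with not (r = j = ν),
`Σ''_{k=0}^{ν} β_k^j V_r(-cos(kπ/ν)) = 0`, where `β_k = (1 - cos(kπ/ν))/2`. -/
theorem dsum_eq_zero (ν j r : ℕ) (hν : 2 ≤ ν) (hj1 : 1 ≤ j) (hjν : j ≤ ν)
    (hjr : j ≤ r) (hrν : r ≤ ν) (hne : ¬(r = j ∧ j = ν)) :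
    dsum ν (fun k => ((1 - Real.cos (k * π / ν)) / 2) ^ j *
      chebV r (-Real.cos (k * π / ν))) = 0 := by
  obtain ⟨i, rfl⟩ : ∃ i, j = i + 1 := ⟨j - 1, by omega⟩
  have hsplit : ∀ k : ℕ, ((1 - Real.cos (k * π / ν)) / 2) ^ (i + 1) *
      chebV r (-Real.cos (k * π / ν)) =
      (-1) ^ r / 2 * (((1 - Real.cos (k * π / ν)) / 2) ^ i * Real.cos (r * (k * π / ν))) +
      (-1) ^ (r + 1) / 2 * (((1 - Real.cos (k * π / ν)) / 2) ^ i *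
        Real.cos ((r + 1 : ℕ) * (k * π / ν))) := by
    intro k
    rw [pow_succ]
    linear_combination (1 / 2 * ((1 - Real.cos (k * π / ν)) / 2) ^ i) *
      one_sub_cos_mul_chebV (k * π / ν) r
  simp only [hsplit, dsum_add, dsum_const_mul]
  rw [dsum_pow_mul_cos_eq_zero i r (by omega) (by omega),
    dsum_pow_mul_cos_eq_zero i (r + 1) (by omega) (by omega)]
  ring
end

section
/- For every real η ∈ [-1,1] and every integer r ≥ 2, the integral Q_r(η) = ∫_0^{1-η} W_r(t+η) dt satisfies 2r(r+1)·Q_r(η) = 2(2r+1) - r·W_{r+1}(η) - W_r(η) + (r+1)·W_{r-1}(η). -/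
/-- Chebyshev polynomials of the fourth kind, as functions on ℝ. -/
noncomputable def chebW : ℕ → ℝ → ℝ
  | 0, _ => 1
  | 1, x => 2 * x + 1
  | (n + 2), x => 2 * x * chebW (n + 1) x - chebW n x

open Polynomial in
/-- `W_n = U_n + U_{n-1}`. -/
theorem chebW_eq_eval_U (n : ℕ) (x : ℝ) :
    chebW n x = (Chebyshev.U ℝ n + Chebyshev.U ℝ (n - 1)).eval x := by
  induction n using Nat.twoStepInduction with
  | zero => simp [chebW]
  | one => simp [chebW]
  | more n ih₀ ih₁ =>
    have h := Chebyshev.U_add_two ℝ (n : ℤ)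
    have h' := Chebyshev.U_add_two ℝ ((n : ℤ) - 1)
    rw [chebW, ih₀, ih₁]
    push_cast
    rw [h, show (n : ℤ) + 2 - 1 = n - 1 + 2 by ring, h',
      show (n : ℤ) - 1 + 1 = n by ring, show (n : ℤ) + 1 - 1 = n by ring]
    simp only [eval_add, eval_sub, eval_mul, eval_X, eval_ofNat]
    ring

open Polynomial in
/-- `W_{n+1} - W_n = 2 T_{n+1}`. -/
theorem chebW_succ_sub (n : ℕ) (x : ℝ) :
    chebW (n + 1) x - chebW n x = 2 * (Chebyshev.T ℝ (n + 1)).eval x := by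
  have h := congrArg (eval x) (Chebyshev.T_eq_U_sub_X_mul_U ℝ ((n : ℤ) + 1))
  have h' := congrArg (eval x) (Chebyshev.U_add_two ℝ ((n : ℤ) - 1))
  rw [show (n : ℤ) - 1 + 2 = n + 1 by ring, show (n : ℤ) - 1 + 1 = n by ring] at h'
  rw [chebW_eq_eval_U, chebW_eq_eval_U]
  push_cast
  rw [show (n : ℤ) + 1 - 1 = n by ring] at h ⊢
  simp only [eval_add, eval_sub, eval_mul, eval_X, eval_ofNat] at h h' ⊢
  linarith

open Polynomial in
/-- Integral of `W_{n+1}` through Chebyshev polynomials of the first kind. -/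
theorem integral_chebW_succ (n : ℕ) (a b : ℝ) :
    ∫ x in a..b, chebW (n + 1) x =
      (Chebyshev.T ℝ (n + 2) * C ((n + 2 : ℝ)⁻¹) +
        Chebyshev.T ℝ (n + 1) * C ((n + 1 : ℝ)⁻¹)).eval b -
      (Chebyshev.T ℝ (n + 2) * C ((n + 2 : ℝ)⁻¹) +
        Chebyshev.T ℝ (n + 1) * C ((n + 1 : ℝ)⁻¹)).eval a := by
  have hW : chebW (n + 1) =
      fun x => (Chebyshev.U ℝ (n + 1) + Chebyshev.U ℝ n).eval x := by
    funext x
    rw [chebW_eq_eval_U]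
    push_cast
    rw [show (n : ℤ) + 1 - 1 = n by ring]
  let F : ℝ[X] :=
    Chebyshev.T ℝ (n + 2) * C ((n + 2 : ℝ)⁻¹) + Chebyshev.T ℝ (n + 1) * C ((n + 1 : ℝ)⁻¹)
  refine intervalIntegral.integral_eq_sub_of_hasDerivAt (f := fun x => F.eval x)
    (fun x _ => ?_) ?_
  · refine (F.hasDerivAt x).congr_deriv ?_
    rw [hW]
    simp only [F, derivative_add, derivative_mul, derivative_C, Chebyshev.T_derivative_eq_U,
      show (n : ℤ) + 2 - 1 = n + 1 by ring, show (n : ℤ) + 1 - 1 = n by ring]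
    have h₁ : (n + 1 : ℝ) ≠ 0 := by positivity
    have h₂ : (n + 2 : ℝ) ≠ 0 := by positivity
    simp
    field_simp
  · rw [hW]
    exact (Polynomial.continuous _).intervalIntegrable _ _

/-- Equation (11): for η ∈ [-1,1] and r ≥ 2, the integral
`Q_r(η) = ∫_0^{1-η} W_r(t+η) dt` satisfies
`2r(r+1) Q_r(η) = 2(2r+1) - r W_{r+1}(η) - W_r(η) + (r+1) W_{r-1}(η)`. -/
theorem Q_recurrence (η : ℝ) (hη : η ∈ Set.Icc (-1 : ℝ) 1) (r : ℕ) (hr : 2 ≤ r) :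
    2 * r * (r + 1) * (∫ t in (0 : ℝ)..(1 - η), chebW r (t + η)) =
      2 * (2 * r + 1) - r * chebW (r + 1) η - chebW r η + (r + 1) * chebW (r - 1) η := by
  obtain ⟨n, rfl⟩ : ∃ n, r = n + 1 := ⟨r - 1, by omega⟩
  have h₁ := chebW_succ_sub n η
  have h₂ := chebW_succ_sub (n + 1) η
  push_cast at h₂
  rw [show (n : ℤ) + 1 + 1 = n + 2 by ring] at h₂
  rw [intervalIntegral.integral_comp_add_right (fun x => chebW (n + 1) x), integral_chebW_succ]
  simp only [Polynomial.eval_add, Polynomial.eval_mul, Polynomial.eval_C, zero_add,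
    sub_add_cancel, Polynomial.Chebyshev.T_eval_one, Nat.add_sub_cancel]
  push_cast
  have hn₁ : (n + 1 : ℝ) ≠ 0 := by positivity
  have hn₂ : (n + 2 : ℝ) ≠ 0 := by positivity
  rw [show (n + 1 + 1 : ℝ) = n + 2 by ring]
  field_simp
  linear_combination (n + 1 : ℝ) * h₂ + (n + 2 : ℝ) * h₁
end

section
/- Let h > 0, η ∈ [-1,1), and let r ≥ 2 be an integer. Then the following five-term recurrence holds: r(r+3)·I_{r+2}(η) + 2[1 - (1+η)·r(r+2)]·I_{r+1}(η) + 2[(1+2η)·r(r+1) - η - 2]·I_r(η) + 2[1 - (1+η)(r^2-1)]·I_{r-1}(η) + (r+1)(r-2)·I_{r-2}(η) = -r·Q_{r+2}(η) + (2r-1)·Q_{r+1}(η) + 3·Q_r(η) - (2r+3)·Q_{r-1}(η) + (r+1)·Q_{r-2}(η). -/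
/-- `I_r(η) = ∫_0^{1-η} ln(ht/2) W_r(t+η) dt`. -/
noncomputable def Ilog (h : ℝ) (r : ℕ) (η : ℝ) : ℝ :=
  ∫ t in (0 : ℝ)..(1 - η), Real.log (h * t / 2) * chebW r (t + η)

/-- `Q_r(η) = ∫_0^{1-η} W_r(t+η) dt`. -/
noncomputable def Qint (r : ℕ) (η : ℝ) : ℝ :=
  ∫ t in (0 : ℝ)..(1 - η), chebW r (t + η)

theorem chebW_add_two (n : ℕ) (x : ℝ) :
    chebW (n + 2) x = 2 * x * chebW (n + 1) x - chebW n x := rfl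

theorem continuous_chebW (n : ℕ) : Continuous (chebW n) := by
  induction n using Nat.twoStepInduction with
  | zero => exact continuous_const
  | one => exact (continuous_const.mul continuous_id).add continuous_const
  | more n h₀ h₁ =>
    exact ((continuous_const.mul continuous_id).mul h₁).sub h₀

/-- The derivative of `chebW`, defined by differentiating the recurrence. -/
noncomputable def chebWDeriv : ℕ → ℝ → ℝ
  | 0, _ => 0
  | 1, _ => 2
  | (n + 2), x => 2 * chebW (n + 1) x + 2 * x * chebWDeriv (n + 1) x - chebWDeriv n x

theorem chebWDeriv_add_two (n : ℕ) (x : ℝ) :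
    chebWDeriv (n + 2) x =
      2 * chebW (n + 1) x + 2 * x * chebWDeriv (n + 1) x - chebWDeriv n x := rfl

theorem hasDerivAt_chebW (n : ℕ) (x : ℝ) : HasDerivAt (chebW n) (chebWDeriv n x) x := by
  induction n using Nat.twoStepInduction with
  | zero => exact hasDerivAt_const x (1 : ℝ)
  | one =>
    have h := ((hasDerivAt_id x).const_mul 2).add_const 1
    rw [mul_one] at h
    exact h
  | more n h₀ h₁ =>
    have h := (((hasDerivAt_id x).const_mul 2).mul h₁).sub h₀
    rw [mul_one] at h
    exact h

/-- The structure relation expressing the derivative of `W_n` times `x² - 1` through `W_n` and `W_{n+1}`. -/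
theorem two_mul_sq_sub_one_mul_chebWDeriv (n : ℕ) (x : ℝ) :
    2 * (x ^ 2 - 1) * chebWDeriv n x =
      (2 * n + 1) * chebW (n + 1) x - (1 + 2 * (n + 1) * x) * chebW n x := by
  induction n using Nat.twoStepInduction with
  | zero => simp [chebW, chebWDeriv]; ring
  | one => simp [chebW, chebWDeriv]; ring
  | more n h₀ h₁ =>
    push_cast at h₁ ⊢
    rw [chebWDeriv_add_two, chebW_add_two (n + 1)]
    rw [chebW_add_two n] at h₁ ⊢
    linear_combination 2 * x * h₁ - h₀

/-- The combination of `W_m, …, W_{m+4}` on the right-hand side of the recurrence for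
`r = m + 2`, with `w` in place of `W`. -/
def chebComb (m : ℕ) (w : ℕ → ℝ) : ℝ :=
  -((m : ℝ) + 2) * w (m + 4) + (2 * m + 3) * w (m + 3) + 3 * w (m + 2)
    - (2 * m + 7) * w (m + 1) + (m + 3) * w m

theorem chebComb_chebW_one (m : ℕ) : chebComb m (fun n => chebW n 1) = 0 := by
  simp only [chebComb, chebW_add_two]
  ring

theorem chebComb_chebWDeriv (m : ℕ) {x : ℝ} (hx : x ^ 2 - 1 ≠ 0) :
    chebComb m (fun n => chebWDeriv n x) =
      -2 * (m + 2) * (m + 4) * chebW (m + 3) x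
        + (4 * (m + 2) * (m + 3) - 2) * chebW (m + 2) x
        - 2 * ((m + 2) ^ 2 - 1) * chebW (m + 1) x := by
  have h₀ := two_mul_sq_sub_one_mul_chebWDeriv m x
  have h₁ := two_mul_sq_sub_one_mul_chebWDeriv (m + 1) x
  apply mul_left_cancel₀ (mul_ne_zero two_ne_zero hx)
  simp only [chebComb, chebWDeriv_add_two, chebW_add_two] at h₀ h₁ ⊢
  push_cast at h₁
  linear_combination
    (-((m : ℝ) + 2) * (8 * x ^ 3 - 4 * x) + (2 * m + 3) * (4 * x ^ 2 - 1) + 6 * x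
      - (2 * m + 7)) * h₁
    + (((m : ℝ) + 2) * (4 * x ^ 2 - 1) - (2 * m + 3) * (2 * x) - 3 + (m + 3)) * h₀

theorem intervalIntegrable_log_mul_chebW {h : ℝ} (hh : 0 < h) (n : ℕ) (η a b : ℝ) :
    IntervalIntegrable (fun t => Real.log (h * t / 2) * chebW n (t + η))
      MeasureTheory.volume a b := by
  have hlog : IntervalIntegrable (fun t => Real.log (h * t / 2)) MeasureTheory.volume a b := by
    have := (intervalIntegral.intervalIntegrable_log' (a := (h / 2) * a)
      (b := (h / 2) * b)).comp_mul_left (c := h / 2)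
    have hne : h / 2 ≠ 0 := by positivity
    simp only [mul_div_cancel_left₀ _ hne] at this
    refine this.congr fun t _ => ?_
    congr 1
    ring
  exact hlog.mul_continuousOn
    ((continuous_chebW n).comp (continuous_id.add continuous_const)).continuousOn

theorem intervalIntegrable_chebW (n : ℕ) (η a b : ℝ) :
    IntervalIntegrable (fun t => chebW n (t + η)) MeasureTheory.volume a b :=
  ((continuous_chebW n).comp (continuous_id.add continuous_const)).intervalIntegrable a b

theorem continuous_log_mul_self {h : ℝ} (hh : 0 < h) :
    Continuous fun t : ℝ => Real.log (h * t / 2) * t := by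
  have hlin : Continuous fun t : ℝ => h / 2 * t := by fun_prop
  refine ((Real.continuous_mul_log.comp hlin).const_mul (2 / h)).congr fun t => ?_
  have : h * t / 2 = h / 2 * t := by ring
  simp only [Function.comp_apply, this]
  field_simp

theorem hasDerivAt_chebComb (m : ℕ) (η t : ℝ) :
    HasDerivAt (fun t => chebComb m fun n => chebW n (t + η))
      (chebComb m fun n => chebWDeriv n (t + η)) t := by
  have H (n : ℕ) : HasDerivAt (fun t => chebW n (t + η)) (chebWDeriv n (t + η)) t :=
    (hasDerivAt_chebW n (t + η)).comp_add_const t η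
  exact (((((H (m + 4)).const_mul _).add ((H (m + 3)).const_mul _)).add
    ((H (m + 2)).const_mul _)).sub ((H (m + 1)).const_mul _)).add ((H m).const_mul _)

theorem hasDerivAt_log_mul_chebComb {h : ℝ} (hh : 0 < h) (m : ℕ) {η t : ℝ} (ht : 0 < t)
    (hx : (t + η) ^ 2 - 1 ≠ 0) :
    HasDerivAt
      (fun t => Real.log (h * t / 2) * t * chebComb m fun n => chebW n (t + η))
      (-(((m : ℝ) + 2) * (m + 5) * (Real.log (h * t / 2) * chebW (m + 4) (t + η))
        + 2 * (1 - (1 + η) * (m + 2) * (m + 4))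
          * (Real.log (h * t / 2) * chebW (m + 3) (t + η))
        + 2 * ((1 + 2 * η) * (m + 2) * (m + 3) - η - 2)
          * (Real.log (h * t / 2) * chebW (m + 2) (t + η))
        + 2 * (1 - (1 + η) * (((m : ℝ) + 2) ^ 2 - 1))
          * (Real.log (h * t / 2) * chebW (m + 1) (t + η))
        + ((m : ℝ) + 3) * m * (Real.log (h * t / 2) * chebW m (t + η)))
      + (-((m : ℝ) + 2) * chebW (m + 4) (t + η) + (2 * m + 3) * chebW (m + 3) (t + η)
        + 3 * chebW (m + 2) (t + η) - (2 * m + 7) * chebW (m + 1) (t + η)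
        + (m + 3) * chebW m (t + η))) t := by
  have hlog : HasDerivAt (fun t => Real.log (h * t / 2)) t⁻¹ t := by
    have hd : HasDerivAt (fun t => h * t / 2) (h * 1 / 2) t :=
      ((hasDerivAt_id t).const_mul h).div_const 2
    refine (hd.log (by positivity)).congr_deriv ?_
    field_simp
  refine ((hlog.mul (hasDerivAt_id t)).mul (hasDerivAt_chebComb m η t)).congr_deriv ?_
  rw [chebComb_chebWDeriv m hx]
  simp only [chebComb, id, chebW_add_two, Pi.mul_apply, inv_mul_cancel₀ ht.ne']
  ring

/-- Equation (10): the five-term recurrence for `I_r(η)`, for h > 0, η ∈ [-1,1), r ≥ 2: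
`r(r+3) I_{r+2} + 2[1-(1+η)r(r+2)] I_{r+1} + 2[(1+2η)r(r+1)-η-2] I_r
 + 2[1-(1+η)(r²-1)] I_{r-1} + (r+1)(r-2) I_{r-2}
 = -r Q_{r+2} + (2r-1) Q_{r+1} + 3 Q_r - (2r+3) Q_{r-1} + (r+1) Q_{r-2}`. -/
theorem I_recurrence (h η : ℝ) (hh : 0 < h) (hη : η ∈ Set.Ico (-1 : ℝ) 1)
    (r : ℕ) (hr : 2 ≤ r) :
    (r : ℝ) * (r + 3) * Ilog h (r + 2) η
      + 2 * (1 - (1 + η) * r * (r + 2)) * Ilog h (r + 1) η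
      + 2 * ((1 + 2 * η) * r * (r + 1) - η - 2) * Ilog h r η
      + 2 * (1 - (1 + η) * ((r : ℝ) ^ 2 - 1)) * Ilog h (r - 1) η
      + ((r : ℝ) + 1) * ((r : ℝ) - 2) * Ilog h (r - 2) η =
    -(r : ℝ) * Qint (r + 2) η
      + (2 * (r : ℝ) - 1) * Qint (r + 1) η
      + 3 * Qint r η
      - (2 * (r : ℝ) + 3) * Qint (r - 1) η
      + ((r : ℝ) + 1) * Qint (r - 2) η := by
  obtain ⟨m, rfl⟩ := Nat.exists_eq_add_of_le' hr
  obtain ⟨hη₁, hη₂⟩ := hη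
  have IL (n : ℕ) := intervalIntegrable_log_mul_chebW hh n η 0 (1 - η)
  have IW (n : ℕ) := intervalIntegrable_chebW n η 0 (1 - η)
  have hcont : Continuous
      fun t => Real.log (h * t / 2) * t * chebComb m fun n => chebW n (t + η) :=
    (continuous_log_mul_self hh).mul
      (continuous_iff_continuousAt.2 fun t => (hasDerivAt_chebComb m η t).continuousAt)
  have key := intervalIntegral.integral_eq_sub_of_hasDerivAt_of_le
    (a := 0) (b := 1 - η) (by linarith) hcont.continuousOn
    (fun t ht => hasDerivAt_log_mul_chebComb hh m ht.1
      (by nlinarith [ht.1, ht.2] : (t + η) ^ 2 - 1 < 0).ne)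
    ((((((IL (m + 4)).const_mul _).add ((IL (m + 3)).const_mul _)).add
      ((IL (m + 2)).const_mul _)).add ((IL (m + 1)).const_mul _)).add
      ((IL m).const_mul _) |>.neg |>.add
      (((((IW (m + 4)).const_mul _).add ((IW (m + 3)).const_mul _)).add
      ((IW (m + 2)).const_mul _)).sub ((IW (m + 1)).const_mul _) |>.add
      ((IW m).const_mul _)))
  rw [intervalIntegral.integral_add, intervalIntegral.integral_neg,
    intervalIntegral.integral_add, intervalIntegral.integral_add,
    intervalIntegral.integral_add, intervalIntegral.integral_add,
    intervalIntegral.integral_add, intervalIntegral.integral_sub,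
    intervalIntegral.integral_add, intervalIntegral.integral_add] at key
  · simp only [intervalIntegral.integral_const_mul, sub_add_cancel, chebComb_chebW_one,
      mul_zero, zero_mul, sub_zero] at key
    simp only [Ilog, Qint, Nat.add_sub_cancel, show m + 2 - 1 = m + 1 from rfl]
    push_cast
    linear_combination -key
  all_goals
    repeat' first
      | exact (IL _).const_mul _
      | exact (IW _).const_mul _
      | apply IntervalIntegrable.neg
      | apply IntervalIntegrable.add
end
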